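/- arXiv:0706.0789 — 3 statements merged into one kernel-verified Lean document; each statement's English description precedes it below -/
import Mathlib

section
/- In ℝ² with Lebesgue measure, let r > 0 and let x₁, x₂ be points with |x₁ − x₂| ≤ 2r. Then the area of the set difference of closed disks satisfies ‖B(x₂,r) \ B(x₁,r)‖ ≥ π r |x₁ − x₂| / 2. -/
open Real MeasureTheory Metric

/-- Cartesian coordinates identify the Euclidean plane with `ℝ × ℝ` as measure spaces. -/
lemma measurePreserving_euclideanPlane_prod :
    MeasurePreserving (fun p : EuclideanSpace ℝ (Fin 2) => (p 0, p 1)) volume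
      (volume : Measure (ℝ × ℝ)) :=
  (volume_preserving_finTwoArrow ℝ).comp (PiLp.volume_preserving_ofLp (Fin 2))

/-- A disk of radius `r` in coordinates has area `π r ^ 2`. -/
lemma volume_disk_prod (r : ℝ) (hr : 0 < r) :
    volume {p : ℝ × ℝ | p.1 ^ 2 + p.2 ^ 2 ≤ r ^ 2} = ENNReal.ofReal (π * r ^ 2) := by
  have hD : MeasurableSet {p : ℝ × ℝ | p.1 ^ 2 + p.2 ^ 2 ≤ r ^ 2} :=
    measurableSet_le (by fun_prop) (by fun_prop)
  rw [← measurePreserving_euclideanPlane_prod.measure_preimage hD.nullMeasurableSet]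
  have hball : (fun p : EuclideanSpace ℝ (Fin 2) => (p 0, p 1)) ⁻¹'
      {p : ℝ × ℝ | p.1 ^ 2 + p.2 ^ 2 ≤ r ^ 2} = closedBall 0 r := by
    ext p
    simp only [Set.mem_preimage, Set.mem_ofPred_eq, mem_closedBall, dist_zero_right]
    rw [← sq_le_sq₀ (norm_nonneg p) hr.le, EuclideanSpace.real_norm_sq_eq, Fin.sum_univ_two]
  rw [hball, InnerProductSpace.volume_closedBall_of_dim_even (k := 1) (by simp)]
  rw [← ENNReal.ofReal_pow hr.le, ← ENNReal.ofReal_mul (by positivity)]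
  simp [mul_comm]

/-- Each line parallel to the translation vector meets the difference of a disk and its translate
by `d ≤ 2 r` in length at least `d / (2 r)` times the length of its chord in the disk. -/
lemma volume_chord_sdiff_ge (r d x : ℝ) (hr : 0 < r) (hd : 0 ≤ d) (hdr : d ≤ 2 * r) :
    ENNReal.ofReal (d / (2 * r)) * volume {y : ℝ | x ^ 2 + y ^ 2 ≤ r ^ 2} ≤
      volume {y : ℝ | x ^ 2 + (y - d) ^ 2 ≤ r ^ 2 ∧ ¬ x ^ 2 + y ^ 2 ≤ r ^ 2} := by
  rcases lt_or_ge (r ^ 2) (x ^ 2) with hx | hx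
  · have hempty : {y : ℝ | x ^ 2 + y ^ 2 ≤ r ^ 2} = ∅ := by
      ext y
      simp only [Set.mem_ofPred_eq, Set.mem_empty_iff_false, iff_false, not_le]
      nlinarith [sq_nonneg y]
    simp [hempty]
  set t := d / (2 * r) with ht
  have htr : t * (2 * r) = d := by rw [ht]; field_simp
  have ht0 : 0 ≤ t := by positivity
  have ht1 : t ≤ 1 := by rw [ht, div_le_one (by positivity)]; exact hdr
  set c := √(r ^ 2 - x ^ 2) with hc
  have hc0 : 0 ≤ c := Real.sqrt_nonneg _
  have hc2 : c ^ 2 = r ^ 2 - x ^ 2 := Real.sq_sqrt (by linarith)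
  have hcr : c ≤ r := (sq_le_sq₀ hc0 hr.le).1 (by nlinarith [sq_nonneg x])
  have hct : 2 * c * t ≤ d := by nlinarith
  have hct' : c * t ≤ c := by nlinarith
  calc ENNReal.ofReal t * volume {y : ℝ | x ^ 2 + y ^ 2 ≤ r ^ 2}
      ≤ ENNReal.ofReal t * volume (Set.Icc (-c) c) := by
        gcongr
        intro y hy
        exact abs_le_of_sq_le_sq' (by rw [Set.mem_ofPred_eq] at hy; linarith) hc0
    _ = volume (Set.Ioc (c + d - 2 * c * t) (c + d)) := by
        rw [Real.volume_Icc, Real.volume_Ioc, ← ENNReal.ofReal_mul ht0]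
        congr 1
        ring
    _ ≤ _ := by
        refine measure_mono fun y hy => ?_
        obtain ⟨hy1, hy2⟩ := hy
        refine ⟨?_, ?_⟩
        · have : (y - d) ^ 2 ≤ c ^ 2 := sq_le_sq' (by linarith) (by linarith)
          linarith
        · have : c < y := by linarith
          nlinarith

/-- The difference of a disk translated along the second axis and the disk is measurable. -/
lemma measurableSet_disk_prod_sdiff (r d : ℝ) : MeasurableSet
    {p : ℝ × ℝ | p.1 ^ 2 + (p.2 - d) ^ 2 ≤ r ^ 2 ∧ ¬ p.1 ^ 2 + p.2 ^ 2 ≤ r ^ 2} := by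
  have h₁ : MeasurableSet {p : ℝ × ℝ | p.1 ^ 2 + (p.2 - d) ^ 2 ≤ r ^ 2} :=
    measurableSet_le (by fun_prop) (by fun_prop)
  have h₂ : MeasurableSet {p : ℝ × ℝ | p.1 ^ 2 + p.2 ^ 2 ≤ r ^ 2} :=
    measurableSet_le (by fun_prop) (by fun_prop)
  exact h₁.inter h₂.compl

/-- The area bound for two disks whose centers lie on the second coordinate axis. -/
lemma volume_disk_prod_sdiff_ge (r d : ℝ) (hr : 0 < r) (hd : 0 ≤ d) (hdr : d ≤ 2 * r) :
    ENNReal.ofReal (π * r * d / 2) ≤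
      volume {p : ℝ × ℝ | p.1 ^ 2 + (p.2 - d) ^ 2 ≤ r ^ 2 ∧ ¬ p.1 ^ 2 + p.2 ^ 2 ≤ r ^ 2} := by
  have hD : MeasurableSet {p : ℝ × ℝ | p.1 ^ 2 + p.2 ^ 2 ≤ r ^ 2} :=
    measurableSet_le (by fun_prop) (by fun_prop)
  have hA := measurableSet_disk_prod_sdiff r d
  calc ENNReal.ofReal (π * r * d / 2)
      = ENNReal.ofReal (d / (2 * r)) * volume {p : ℝ × ℝ | p.1 ^ 2 + p.2 ^ 2 ≤ r ^ 2} := by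
        rw [volume_disk_prod r hr, ← ENNReal.ofReal_mul (by positivity)]
        congr 1
        field_simp
    _ ≤ _ := by
        rw [Measure.volume_eq_prod, Measure.prod_apply hD, Measure.prod_apply hA,
          ← lintegral_const_mul _ (measurable_measure_prodMk_left hD)]
        exact lintegral_mono fun x => volume_chord_sdiff_ge r d x hr hd hdr

/-- For two closed disks of the same radius `r` in the plane whose centers are at distance at
most `2r`, the area of the set difference is at least `π r |x₁ - x₂| / 2`. -/
theorem area_disk_sdiff_ge (r : ℝ) (hr : 0 < r)
    (x₁ x₂ : EuclideanSpace ℝ (Fin 2)) (h : dist x₁ x₂ ≤ 2 * r) :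
    ENNReal.ofReal (π * r * dist x₁ x₂ / 2)
      ≤ volume (closedBall x₂ r \ closedBall x₁ r) := by
  set d := dist x₁ x₂ with hd
  have hd0 : 0 ≤ d := dist_nonneg
  let w : EuclideanSpace ℝ (Fin 2) := EuclideanSpace.single 1 d
  have hnorm : ‖x₂ - x₁‖ = ‖w‖ := by
    simp [w, hd, dist_eq_norm, norm_sub_rev]
  let f : EuclideanSpace ℝ (Fin 2) ≃ₗᵢ[ℝ] EuclideanSpace ℝ (Fin 2) :=
    (ℝ ∙ (x₂ - x₁ - w))ᗮ.reflection
  have hf : f (x₂ - x₁) = w := Submodule.reflection_sub hnorm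
  have hmp := measurePreserving_euclideanPlane_prod.comp
    (f.measurePreserving.comp (measurePreserving_sub_right volume x₁))
  have hA := measurableSet_disk_prod_sdiff r d
  refine (volume_disk_prod_sdiff_ge r d hr hd0 h).trans_eq ?_
  rw [← hmp.measure_preimage hA.nullMeasurableSet]
  congr 1
  ext p
  have h₁ : dist p x₁ ^ 2 = f (p - x₁) 0 ^ 2 + f (p - x₁) 1 ^ 2 := by
    rw [dist_eq_norm, ← f.norm_map, EuclideanSpace.real_norm_sq_eq, Fin.sum_univ_two]
  have h₂ : dist p x₂ ^ 2 = f (p - x₁) 0 ^ 2 + (f (p - x₁) 1 - d) ^ 2 := by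
    have hsub : p - x₂ = (p - x₁) - (x₂ - x₁) := by abel
    rw [dist_eq_norm, hsub, ← f.norm_map, map_sub f (p - x₁), hf,
      EuclideanSpace.real_norm_sq_eq, Fin.sum_univ_two]
    simp [w]
  simp only [Set.mem_preimage, Set.mem_ofPred_eq, Function.comp_apply, Set.mem_sdiff,
    mem_closedBall]
  rw [← h₁, ← h₂, sq_le_sq₀ dist_nonneg hr.le, sq_le_sq₀ dist_nonneg hr.le]
end

section
/- Fix d ≥ 1, reals β, τ, c, T > 0, p₁ ∈ [0,1] with p₀ := 1 − p₁, ρ ∈ [0,∞) and a₀ ∈ [0,∞). Let g : [0,∞) → ℝ be measurable with 0 ≤ g(s) ≤ β for all s and g(s) = 0 for s > 2τ/c. Let λ ↦ δ(λ) ∈ (0,1] and λ ↦ γ(λ) ∈ [0,∞) satisfy δ(λ) → 0, λ δ(λ)^d → ρ, and δ(λ) γ(λ) → a₀ as λ → ∞. Then, as λ → ∞, 2 e^{−2 λ δ(λ)^d p₁ β} ∫₀^T ∫₀^{δ(λ)^{−1}(T − s₁)} ( exp( λ δ(λ)^d p₁ g(s) (p₁ + p₀ e^{−δ(λ)γ(λ)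 s}) ) − 1 ) ds ds₁ converges to 2 T e^{−2 p₁ ρ β} ∫₀^{2τ/c} ( exp( p₁ ρ g(s) (p₁ + p₀ e^{−a₀ s}) ) − 1 ) ds. -/
open Real MeasureTheory Filter

/-- If `f` vanishes beyond `M`, its primitive based at `0` is constant beyond `M`. -/
theorem intervalIntegral_eq_of_eq_zero_of_lt {f : ℝ → ℝ} {M R : ℝ}
    (hf : ∀ a b, IntervalIntegrable f volume a b) (hvan : ∀ s, M < s → f s = 0) (hMR : M ≤ R) :
    ∫ s in (0 : ℝ)..R, f s = ∫ s in (0 : ℝ)..M, f s := by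
  rw [← intervalIntegral.integral_add_adjacent_intervals (hf 0 M) (hf M R)]
  have h : ∫ s in M..R, f s = ∫ _ in M..R, (0 : ℝ) := by
    refine intervalIntegral.integral_congr_ae (Eventually.of_forall fun s hs => ?_)
    rw [Set.uIoc_of_le hMR] at hs
    exact hvan s hs.1
  rw [h]
  simp

/-- Dominated convergence for iterated integrals whose inner upper limit is blown up by a
vanishing scale, the inner integrands being uniformly bounded and supported below `M`. -/
theorem tendsto_integral_integral_of_scale {ι : Type*} {l : Filter ι} [l.IsCountablyGenerated]
    {φ : ι → ℝ → ℝ} {φ₀ : ℝ → ℝ} {δ : ι → ℝ} {K M T : ℝ} (hM : 0 ≤ M) (hT : 0 ≤ T)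
    (hφm : ∀ i, Measurable (φ i)) (hφK : ∀ᶠ i in l, ∀ s, |φ i s| ≤ K)
    (hvan : ∀ i s, M < s → φ i s = 0) (hlim : ∀ s, Tendsto (fun i => φ i s) l (nhds (φ₀ s)))
    (hδpos : ∀ i, 0 < δ i) (hδ0 : Tendsto δ l (nhds 0)) :
    Tendsto (fun i => ∫ s₁ in (0 : ℝ)..T, ∫ s in (0 : ℝ)..((δ i)⁻¹ * (T - s₁)), φ i s) l
      (nhds (T * ∫ s in (0 : ℝ)..M, φ₀ s)) := by
  have hint : ∀ᶠ i in l, ∀ a b, IntervalIntegrable (φ i) volume a b := by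
    filter_upwards [hφK] with i hi a b
    exact (intervalIntegrable_const (c := K)).mono_fun (hφm i).aestronglyMeasurable
      (Eventually.of_forall fun s => (hi s).trans (le_abs_self K))
  have hinner : Tendsto (fun i => ∫ s in (0 : ℝ)..M, φ i s) l
      (nhds (∫ s in (0 : ℝ)..M, φ₀ s)) := by
    refine intervalIntegral.tendsto_integral_filter_of_dominated_convergence (fun _ => K)
      (Eventually.of_forall fun i => (hφm i).aestronglyMeasurable) ?_ intervalIntegrable_const
      (Eventually.of_forall fun s _ => hlim s)
    filter_upwards [hφK] with i hi
    exact Eventually.of_forall fun s _ => hi s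
  have hδinv : Tendsto (fun i => (δ i)⁻¹) l atTop :=
    (tendsto_nhdsWithin_iff.2 ⟨hδ0, Eventually.of_forall hδpos⟩).inv_tendsto_nhdsGT_zero
  have hconst : T * ∫ s in (0 : ℝ)..M, φ₀ s
      = ∫ _ in (0 : ℝ)..T, ∫ s in (0 : ℝ)..M, φ₀ s := by simp
  rw [hconst]
  refine intervalIntegral.tendsto_integral_filter_of_dominated_convergence (fun _ => K * M)
    ?_ ?_ intervalIntegrable_const ?_
  · filter_upwards [hint] with i hi
    exact ((intervalIntegral.continuous_primitive hi 0).comp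
      (continuous_const.mul (continuous_const.sub continuous_id))).aestronglyMeasurable
  · filter_upwards [hint, hφK] with i hi hK
    refine Eventually.of_forall fun s₁ hs₁ => ?_
    rw [Set.uIoc_of_le hT] at hs₁
    have hK0 : 0 ≤ K := (abs_nonneg _).trans (hK 0)
    have hbound : ∀ R, 0 ≤ R → R ≤ M → ‖∫ s in (0 : ℝ)..R, φ i s‖ ≤ K * M := by
      intro R hR hRM
      refine (intervalIntegral.norm_integral_le_of_norm_le_const fun s _ => hK s).trans ?_
      rw [sub_zero, abs_of_nonneg hR]
      gcongr
    rcases le_total ((δ i)⁻¹ * (T - s₁)) M with h | h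
    · exact hbound _ (mul_nonneg (inv_nonneg.2 (hδpos i).le) (sub_nonneg.2 hs₁.2)) h
    · rw [intervalIntegral_eq_of_eq_zero_of_lt hi (hvan i) h]
      exact hbound M hM le_rfl
  · filter_upwards [compl_mem_ae_iff.2 (measure_singleton T)] with s₁ hne hs₁
    rw [Set.uIoc_of_le hT] at hs₁
    have hlt : 0 < T - s₁ := sub_pos.2 (lt_of_le_of_ne hs₁.2 hne)
    refine hinner.congr' ?_
    filter_upwards [hint, (hδinv.atTop_mul_const hlt).eventually_ge_atTop M] with i hi hR
    exact (intervalIntegral_eq_of_eq_zero_of_lt hi (hvan i) hR).symm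

/-- The analytic convergence underlying the variance limit `δ⁻¹ Var(V_T(δ)) → σ₁²(a₀)` for
the uncovered time of a target in the Markov–Poisson–Boolean model with scaled shapes. -/
theorem tendsto_scaled_variance_integral (d : ℕ) (hd : 1 ≤ d)
    (β τ c T : ℝ) (hβ : 0 < β) (hτ : 0 < τ) (hc : 0 < c) (hT : 0 < T)
    (p₁ : ℝ) (hp₁0 : 0 ≤ p₁) (hp₁1 : p₁ ≤ 1) (p₀ : ℝ) (hp₀ : p₀ = 1 - p₁)
    (ρ a₀ : ℝ) (hρ : 0 ≤ ρ) (ha₀ : 0 ≤ a₀)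
    (g : ℝ → ℝ) (hgmeas : Measurable g) (hg0 : ∀ s, 0 ≤ s → 0 ≤ g s ∧ g s ≤ β)
    (hgvan : ∀ s, 2 * τ / c < s → g s = 0)
    (δ γ : ℝ → ℝ) (hδ : ∀ lam, δ lam ∈ Set.Ioc (0 : ℝ) 1) (hγ : ∀ lam, 0 ≤ γ lam)
    (hδ0 : Tendsto δ atTop (nhds 0))
    (hδρ : Tendsto (fun lam => lam * δ lam ^ d) atTop (nhds ρ))
    (hδγ : Tendsto (fun lam => δ lam * γ lam) atTop (nhds a₀)) :
    Tendsto
      (fun lam : ℝ =>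
        2 * Real.exp (-(2 * lam * δ lam ^ d * p₁ * β)) *
          ∫ s₁ in (0 : ℝ)..T, ∫ s in (0 : ℝ)..((δ lam)⁻¹ * (T - s₁)),
            (Real.exp (lam * δ lam ^ d * p₁ * g s * (p₁ + p₀ * Real.exp (-(δ lam * γ lam * s))))
              - 1))
      atTop
      (nhds (2 * T * Real.exp (-(2 * p₁ * ρ * β)) *
        ∫ s in (0 : ℝ)..(2 * τ / c),
          (Real.exp (p₁ * ρ * g s * (p₁ + p₀ * Real.exp (-(a₀ * s)))) - 1))) := by
  set G : ℝ → ℝ := (Set.Ici 0).indicator g with hG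
  have hGg : ∀ s, 0 ≤ s → G s = g s := fun s hs => Set.indicator_of_mem (Set.mem_Ici.2 hs) g
  have hGbd : ∀ s, 0 ≤ G s ∧ G s ≤ β := by
    intro s
    by_cases hs : 0 ≤ s
    · rw [hGg s hs]
      exact hg0 s hs
    · rw [hG, Set.indicator_of_notMem (by simpa using hs)]
      exact ⟨le_rfl, hβ.le⟩
  have hM : 0 ≤ 2 * τ / c := by positivity
  have hGvan : ∀ s, 2 * τ / c < s → G s = 0 := fun s hs => by
    rw [hGg s (hM.trans hs.le), hgvan s hs]
  have hGm : Measurable G := hgmeas.indicator measurableSet_Ici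
  set φ : ℝ → ℝ → ℝ := fun lam s => Real.exp (lam * δ lam ^ d * p₁ * (G s) *
    (p₁ + p₀ * Real.exp (-(δ lam * γ lam * max s 0)))) - 1 with hφ
  have hp₀0 : 0 ≤ p₀ := by linarith
  have hmain := tendsto_integral_integral_of_scale (l := atTop) (φ := φ)
    (φ₀ := fun s => Real.exp (p₁ * ρ * G s * (p₁ + p₀ * Real.exp (-(a₀ * max s 0)))) - 1)
    (K := Real.exp ((ρ + 1) * β)) hM hT.le
    (fun lam => by fun_prop) ?_
    (fun lam s hs => by simp [hφ, hGvan s hs]) ?_ (fun lam => (hδ lam).1) hδ0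
  · have hfront : Tendsto (fun lam => 2 * Real.exp (-(2 * lam * δ lam ^ d * p₁ * β))) atTop
        (nhds (2 * Real.exp (-(2 * p₁ * ρ * β)))) := by
      have h := ((((hδρ.const_mul (2 * p₁)).mul_const β).neg).rexp).const_mul 2
      refine h.congr fun lam => ?_
      ring_nf
    have hprod := hfront.mul hmain
    have hlimit : 2 * T * Real.exp (-(2 * p₁ * ρ * β)) * (∫ s in (0 : ℝ)..(2 * τ / c),
          (Real.exp (p₁ * ρ * g s * (p₁ + p₀ * Real.exp (-(a₀ * s)))) - 1))
        = 2 * Real.exp (-(2 * p₁ * ρ * β)) * (T * ∫ s in (0 : ℝ)..(2 * τ / c),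
          (Real.exp (p₁ * ρ * G s * (p₁ + p₀ * Real.exp (-(a₀ * max s 0)))) - 1)) := by
      have h : ∫ s in (0 : ℝ)..(2 * τ / c),
            (Real.exp (p₁ * ρ * g s * (p₁ + p₀ * Real.exp (-(a₀ * s)))) - 1)
          = ∫ s in (0 : ℝ)..(2 * τ / c),
            (Real.exp (p₁ * ρ * G s * (p₁ + p₀ * Real.exp (-(a₀ * max s 0)))) - 1) := by
        refine intervalIntegral.integral_congr fun s hs => ?_
        rw [Set.uIcc_of_le hM] at hs
        simp only [hGg s hs.1, max_eq_left hs.1]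
      rw [h]
      ring
    rw [hlimit]
    refine hprod.congr fun lam => ?_
    congr 1
    refine intervalIntegral.integral_congr fun s₁ hs₁ => ?_
    rw [Set.uIcc_of_le hT.le] at hs₁
    refine intervalIntegral.integral_congr fun s hs => ?_
    rw [Set.uIcc_of_le (mul_nonneg (inv_nonneg.2 (hδ lam).1.le) (sub_nonneg.2 hs₁.2))] at hs
    simp only [hφ, hGg s hs.1, max_eq_left hs.1]
  · filter_upwards [hδρ.eventually_le_const (lt_add_one ρ), eventually_ge_atTop 0]
      with lam hlam hlam0 s
    have hx0 : 0 ≤ lam * δ lam ^ d := mul_nonneg hlam0 (pow_nonneg (hδ lam).1.le d)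
    have he1 : Real.exp (-(δ lam * γ lam * max s 0)) ≤ 1 :=
      Real.exp_le_one_iff.2 (neg_nonpos.2
        (mul_nonneg (mul_nonneg (hδ lam).1.le (hγ lam)) (le_max_right s 0)))
    have hw0 : 0 ≤ p₁ + p₀ * Real.exp (-(δ lam * γ lam * max s 0)) := by positivity
    have hw1 : p₁ + p₀ * Real.exp (-(δ lam * γ lam * max s 0)) ≤ 1 := by nlinarith
    have hG0 := (hGbd s).1
    have hlow : 0 ≤ lam * δ lam ^ d * p₁ * G s *
        (p₁ + p₀ * Real.exp (-(δ lam * γ lam * max s 0))) := by positivity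
    have hup : lam * δ lam ^ d * p₁ * G s *
        (p₁ + p₀ * Real.exp (-(δ lam * γ lam * max s 0))) ≤ (ρ + 1) * β :=
      calc _ ≤ (ρ + 1) * 1 * β * 1 := by
            gcongr
            exact (hGbd s).2
        _ = (ρ + 1) * β := by ring
    have h1 := Real.one_le_exp hlow
    have h2 := Real.exp_le_exp.2 hup
    simp only [hφ]
    rw [abs_of_nonneg (by linarith)]
    linarith
  · intro s
    have h := (((hδρ.mul_const p₁).mul_const (G s)).mul
      ((((hδγ.mul_const (max s 0)).neg.rexp).const_mul p₀).const_add p₁)).rexp.sub_const 1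
    rw [mul_comm ρ p₁] at h
    exact h
end

section
/- Fix d ≥ 1, τ > 0, a bounded Borel set R ⊆ ℝ^d, ρ ∈ [0,∞), and integers m, n ≥ 0. Let (E, ℰ, κ) be a probability space and K a map from E to subsets of the closed ball B(0,τ) ⊆ ℝ^d with {(e,x) : x ∈ K e} product-measurable; set β := ∫_E ‖K e‖ dκ(e), G₁(y) := ∫_E ‖(y + K e) ∩ K e‖ dκ(e) and G₂(y) := β − G₁(y), where ‖·‖ is d-dimensional Lebesgue measure. For λ > 0 and δ ∈ (0,1] define f_δ(x) := ∫_{δ^{−1}(x−R) ∩ B(0,2τ)} ( e^{λδ^d G₁(y)} Σ_{l=0}^{m∧n} (λδ^d G₁(y))^l / l! · (λδ^d G₂(y))^{m+n−2l} / ((m−l)!(n−l)!) − (λδ^d β)^{m+n} / (m! n!) ) dy. If δ = δ(λ) → 0 and λ δ(λ)^d → ρ as λ → ∞, then for every x in the interior of R, f_δ(x) converges to c₀ := ∫_{B(0,2τ)} ( e^{ρ G₁(y)} Σ_{l=0}^{m∧n} (ρ G₁(y))^l / l! · (ρ G₂(y))^{m+n−2l} / ((m−l)!(n−l)!) − (ρβ)^{m+n}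 / (m! n!) ) dy. -/
open Real MeasureTheory Filter Metric

/-- Dominated convergence for `∫ Φ (a, g y) dμ` with `Φ` continuous and `g` bounded. -/
lemma tendsto_integral_comp_of_continuous {α ι : Type*} [MeasurableSpace α] {μ : Measure α}
    [IsFiniteMeasure μ] {l : Filter ι} [l.IsCountablyGenerated] {Φ : ℝ × ℝ → ℝ}
    (hΦ : Continuous Φ) {g : α → ℝ} (hg : Measurable g) {V : ℝ} (hV : ∀ y, |g y| ≤ V)
    {a : ι → ℝ} {ρ : ℝ} (ha : Tendsto a l (nhds ρ)) :
    Tendsto (fun i => ∫ y, Φ (a i, g y) ∂μ) l (nhds (∫ y, Φ (ρ, g y) ∂μ)) := by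
  obtain ⟨C, hC⟩ := ((isCompact_Icc (a := ρ - 1) (b := ρ + 1)).prod
    (isCompact_Icc (a := -V) (b := V))).exists_bound_of_continuousOn hΦ.continuousOn
  refine tendsto_integral_filter_of_dominated_convergence (fun _ => C) ?_ ?_
    (integrable_const C) ?_
  · exact Eventually.of_forall fun i =>
      (hΦ.measurable.comp (measurable_const.prodMk hg)).aestronglyMeasurable
  · filter_upwards [ha.eventually (Icc_mem_nhds (sub_one_lt ρ) (lt_add_one ρ))] with i hi
    exact Eventually.of_forall fun y => hC _ ⟨hi, abs_le.mp (hV y)⟩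
  · exact Eventually.of_forall fun y =>
      (hΦ.tendsto (ρ, g y)).comp (ha.prodMk_nhds tendsto_const_nhds)

/-- The mean covariogram `y ↦ ∫ ‖(y + K e) ∩ K e‖ dκ(e)` of a random set is measurable. -/
lemma measurable_integral_volume_translate_inter {d : ℕ} {E : Type*} [MeasurableSpace E]
    (κ : Measure E) [SFinite κ] {K : E → Set (EuclideanSpace ℝ (Fin d))}
    (hK : MeasurableSet {p : E × EuclideanSpace ℝ (Fin d) | p.2 ∈ K p.1}) :
    Measurable fun y : EuclideanSpace ℝ (Fin d) =>
      ∫ e, (volume ((fun z => y + z) '' K e ∩ K e)).toReal ∂κ := by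
  have hS : MeasurableSet {q : (EuclideanSpace ℝ (Fin d) × E) × EuclideanSpace ℝ (Fin d) |
      q.2 - q.1.1 ∈ K q.1.2 ∧ q.2 ∈ K q.1.2} := by
    have h₁ : Measurable fun q : (EuclideanSpace ℝ (Fin d) × E) × EuclideanSpace ℝ (Fin d) =>
        (q.1.2, q.2 - q.1.1) := by fun_prop
    have h₂ : Measurable fun q : (EuclideanSpace ℝ (Fin d) × E) × EuclideanSpace ℝ (Fin d) =>
        (q.1.2, q.2) := by fun_prop
    exact (h₁ hK).inter (h₂ hK)
  have hvol := (measurable_measure_prodMk_left (ν := (volume :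
    Measure (EuclideanSpace ℝ (Fin d)))) hS).ennreal_toReal
  have himage : ∀ (y : EuclideanSpace ℝ (Fin d)) (e : E), (fun z => y + z) '' K e ∩ K e =
      {z | z - y ∈ K e ∧ z ∈ K e} := by
    intro y e
    ext z
    simp [sub_eq_neg_add]
  simp only [himage]
  exact (hvol.stronglyMeasurable.integral_prod_right' (ν := κ)).measurable

/-- Blowing up a neighbourhood of `x` around `x` eventually covers every fixed ball. -/
lemma eventually_closedBall_subset_rescaled {F : Type*} [NormedAddCommGroup F] [NormedSpace ℝ F]
    {ι : Type*} {l : Filter ι} {R : Set F} {x : F} (hx : x ∈ interior R) {δ : ι → ℝ}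
    (hδpos : ∀ i, 0 < δ i) (hδ : Tendsto δ l (nhds 0)) {s : ℝ} (hs : 0 < s) :
    ∀ᶠ i in l, closedBall (0 : F) s ⊆ {y | ∃ z ∈ R, y = (δ i)⁻¹ • (x - z)} := by
  obtain ⟨ε, hε, hball⟩ := Metric.mem_nhds_iff.mp (mem_interior_iff_mem_nhds.mp hx)
  filter_upwards [hδ.eventually (gt_mem_nhds (div_pos hε hs))] with i hi y hy
  refine ⟨x - δ i • y, hball ?_, ?_⟩
  · rw [mem_closedBall_zero_iff] at hy
    rw [mem_ball, dist_eq_norm, sub_sub_cancel_left, norm_neg, norm_smul, Real.norm_eq_abs,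
      abs_of_pos (hδpos i)]
    calc δ i * ‖y‖ ≤ δ i * s := mul_le_mul_of_nonneg_left hy (hδpos i).le
      _ < ε := (lt_div_iff₀ hs).mp hi
  · rw [sub_sub_cancel, smul_smul, inv_mul_cancel₀ (hδpos i).ne', one_smul]

/-- Dominated-convergence limit of `f_δ(x)`: the key step in the variance asymptotics
`λ Var(V_k) → σ²` for the `k`-vacancy of the scaled Poisson–Boolean model. -/
theorem tendsto_f_delta (d : ℕ) (hd : 1 ≤ d) (τ : ℝ) (hτ : 0 < τ)
    (R : Set (EuclideanSpace ℝ (Fin d))) (hRb : Bornology.IsBounded R) (hRm : MeasurableSet R)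
    (ρ : ℝ) (hρ : 0 ≤ ρ) (m n : ℕ)
    (E : Type) [MeasurableSpace E] (κ : Measure E) [IsProbabilityMeasure κ]
    (K : E → Set (EuclideanSpace ℝ (Fin d)))
    (hKτ : ∀ e, K e ⊆ closedBall (0 : EuclideanSpace ℝ (Fin d)) τ)
    (hKmeas : MeasurableSet {p : E × EuclideanSpace ℝ (Fin d) | p.2 ∈ K p.1})
    (β : ℝ) (hβdef : β = ∫ e, (volume (K e)).toReal ∂κ)
    (G₁ G₂ : EuclideanSpace ℝ (Fin d) → ℝ)
    (hG₁ : ∀ y, G₁ y = ∫ e, (volume ((fun z => y + z) '' K e ∩ K e)).toReal ∂κ)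
    (hG₂ : ∀ y, G₂ y = β - G₁ y)
    (δ : ℝ → ℝ) (hδmem : ∀ lam, δ lam ∈ Set.Ioc (0 : ℝ) 1)
    (hδ0 : Tendsto δ atTop (nhds 0))
    (hδρ : Tendsto (fun lam => lam * δ lam ^ d) atTop (nhds ρ))
    (x : EuclideanSpace ℝ (Fin d)) (hx : x ∈ interior R) :
    Tendsto
      (fun lam : ℝ =>
        ∫ y in {y : EuclideanSpace ℝ (Fin d) | ∃ z ∈ R, y = (δ lam)⁻¹ • (x - z)} ∩
            closedBall (0 : EuclideanSpace ℝ (Fin d)) (2 * τ),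
          (Real.exp (lam * δ lam ^ d * G₁ y) *
              ∑ l ∈ Finset.range (min m n + 1),
                (lam * δ lam ^ d * G₁ y) ^ l / l.factorial *
                  ((lam * δ lam ^ d * G₂ y) ^ (m + n - 2 * l) /
                    ((m - l).factorial * (n - l).factorial))
            - (lam * δ lam ^ d * β) ^ (m + n) / (m.factorial * n.factorial)))
      atTop
      (nhds
        (∫ y in closedBall (0 : EuclideanSpace ℝ (Fin d)) (2 * τ),
          (Real.exp (ρ * G₁ y) *
              ∑ l ∈ Finset.range (min m n + 1),
                (ρ * G₁ y) ^ l / l.factorial *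
                  ((ρ * G₂ y) ^ (m + n - 2 * l) /
                    ((m - l).factorial * (n - l).factorial))
            - (ρ * β) ^ (m + n) / (m.factorial * n.factorial)))) := by
  have hmeas : Measurable G₁ := by
    rw [funext hG₁]
    exact measurable_integral_volume_translate_inter κ hKmeas
  have hbound : ∀ y, |G₁ y| ≤
      (volume (closedBall (0 : EuclideanSpace ℝ (Fin d)) τ)).toReal := by
    intro y
    rw [hG₁ y, ← Real.norm_eq_abs]
    refine (norm_integral_le_of_norm_le_const (Eventually.of_forall fun e => ?_)).trans_eq
      (by rw [probReal_univ, mul_one])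
    rw [Real.norm_of_nonneg ENNReal.toReal_nonneg]
    exact ENNReal.toReal_mono measure_closedBall_lt_top.ne
      (measure_mono (Set.inter_subset_right.trans (hKτ e)))
  have : IsFiniteMeasure (volume.restrict
      (closedBall (0 : EuclideanSpace ℝ (Fin d)) (2 * τ))) :=
    isFiniteMeasure_restrict.mpr measure_closedBall_lt_top.ne
  have hlim := tendsto_integral_comp_of_continuous
    (μ := volume.restrict (closedBall (0 : EuclideanSpace ℝ (Fin d)) (2 * τ)))
    (Φ := fun p : ℝ × ℝ => Real.exp (p.1 * p.2) *
      ∑ l ∈ Finset.range (min m n + 1),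
        (p.1 * p.2) ^ l / l.factorial *
          ((p.1 * (β - p.2)) ^ (m + n - 2 * l) / ((m - l).factorial * (n - l).factorial))
      - (p.1 * β) ^ (m + n) / (m.factorial * n.factorial))
    (by fun_prop) hmeas hbound hδρ
  simp only [hG₂]
  refine hlim.congr' ?_
  filter_upwards [eventually_closedBall_subset_rescaled hx (fun lam => (hδmem lam).1) hδ0
    (mul_pos two_pos hτ)] with lam hlam
  rw [Set.inter_eq_right.mpr hlam]
end
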